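/- There exists a polynomial poly_2 such that for every 1-VASS with disequality tests V=(Q,D,Δ,w) (with single disequality guards), every residue class R, and every n ∈ ℕ the following holds: if R contains a chain that is (n+1)-active but not n-active, then |δ_{n+1}(R)| ≤ max{|δ_n(R')| : R' a residue class} + poly_2(|Q|). -/

import Mathlib

namespace VASSPaper

/-- A 1-VASS with disequality tests: states `Q`, transition relation `delta`,
integer weights `w`, and for each state a cofinite set `D q ⊆ ℕ` of allowed counter values. -/
structure OneVASS (Q : Type) where
  delta : Q → Q → Prop
  w : Q → Q → ℤ
  D : Q → Set ℕ
  cofinite : ∀ q, (D q)ᶜ.Finite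

variable {Q : Type}

/-- A path is a nonempty sequence of states joined by transitions. -/
def IsPath (V : OneVASS Q) : List Q → Prop
  | [] => False
  | [_] => True
  | a :: b :: l => V.delta a b ∧ IsPath V (b :: l)

/-- The weight of a path: the sum of the weights of its transitions. -/
def pathWeight (V : OneVASS Q) (π : List Q) : ℤ :=
  (List.zipWith V.w π π.tail).sum

/-- The counter value at position `i` of the run over `π` starting with counter `z`. -/
def counterAt (V : OneVASS Q) (z : ℕ) (π : List Q) (i : ℕ) : ℤ :=
  (z : ℤ) + pathWeight V (π.take (i + 1))

/-- `π` lifts to a run from counter value `z`: all counter values stay nonnegative. -/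
def IsRun (V : OneVASS Q) (π : List Q) (z : ℕ) : Prop :=
  IsPath V π ∧ ∀ i, i < π.length → 0 ≤ counterAt V z π i

/-- A valid run additionally respects all disequality guards. -/
def IsValidRun (V : OneVASS Q) (π : List Q) (z : ℕ) : Prop :=
  IsRun V π z ∧ ∀ i, ∀ h : i < π.length, (counterAt V z π i).toNat ∈ V.D (π.get ⟨i, h⟩)

/-- `π` goes from configuration `c` to configuration `c'`. -/
def RunFromTo (V : OneVASS Q) (π : List Q) (c c' : Q × ℕ) : Prop :=
  π.head? = some c.1 ∧ π.getLast? = some c'.1 ∧ (c'.2 : ℤ) = (c.2 : ℤ) + pathWeight V π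

/-- `c'` is reachable from `c` by a valid run. -/
def Reaches (V : OneVASS Q) (c c' : Q × ℕ) : Prop :=
  ∃ π, IsValidRun V π c.2 ∧ RunFromTo V π c c'

/-- A configuration is unbounded if infinitely many configurations are reachable from it. -/
def Unbounded (V : OneVASS Q) (c : Q × ℕ) : Prop :=
  {c' | Reaches V c c'}.Infinite

/-- `(s,0)` covers the state `t`. -/
def Covers (V : OneVASS Q) (s t : Q) : Prop :=
  ∃ z, Reaches V (s, 0) (t, z)

/-- Every state has at most one disequality guard. -/
def SingleGuard (V : OneVASS Q) : Prop :=
  ∀ q, V.D q = Set.univ ∨ ∃ g : ℕ, V.D q = {g}ᶜ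

/-- The minimum weight of a (possibly empty) prefix of `π`. -/
def pmin (V : OneVASS Q) (π : List Q) : ℤ :=
  ((List.range (π.length + 1)).map fun i => pathWeight V (π.take i)).foldr min 0

/-- The maximum weight of a (possibly empty) suffix of `π`. -/
def smax (V : OneVASS Q) (π : List Q) : ℤ :=
  ((List.range (π.length + 1)).map fun i => pathWeight V (π.drop i)).foldr max 0

/-- A cycle on `q`: a path with at least one transition starting and ending at `q`. -/
def IsCycleOn (V : OneVASS Q) (π : List Q) (q : Q) : Prop :=
  IsPath V π ∧ 2 ≤ π.length ∧ π.head? = some q ∧ π.getLast? = some q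

/-- A simple cycle on `q`. -/
def IsSimpleCycleOn (V : OneVASS Q) (π : List Q) (q : Q) : Prop :=
  IsCycleOn V π q ∧ π.dropLast.Nodup

/-- The set of states lying on a positive-weight simple cycle. -/
def Qplus (V : OneVASS Q) : Set Q :=
  {q | ∃ π, IsSimpleCycleOn V π q ∧ 0 < pathWeight V π}

/-- `γ` is a valid choice of cycles: for each `q ∈ Q₊`, `γ q` is a simple positive cycle
on `q` whose `pmin` is maximal among all positive-weight simple cycles on `q`. -/
def GammaChoice (V : OneVASS Q) (γ : Q → List Q) : Prop :=
  ∀ q ∈ Qplus V,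
    IsSimpleCycleOn V (γ q) q ∧ 0 < pathWeight V (γ q) ∧
      ∀ π, IsSimpleCycleOn V π q → 0 < pathWeight V π → pmin V π ≤ pmin V (γ q)

/-- `Conf₊`: configurations `(q,z)` with `q ∈ Q₊` and `z + pmin (γ q) ≥ 0`. -/
def ConfPlus (V : OneVASS Q) (γ : Q → List Q) : Set (Q × ℕ) :=
  {c | c.1 ∈ Qplus V ∧ 0 ≤ (c.2 : ℤ) + pmin V (γ c.1)}

/-- `W_q`, the weight of the chosen cycle `γ q`, as a natural number. -/
def Wnat (V : OneVASS Q) (γ : Q → List Q) (q : Q) : ℕ :=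
  (pathWeight V (γ q)).toNat

/-- The `q`-residue class of `r` modulo `W_q`. -/
def resClass (V : OneVASS Q) (γ : Q → List Q) (q : Q) (r : ℕ) : Set (Q × ℕ) :=
  {c | c ∈ ConfPlus V γ ∧ c.1 = q ∧ c.2 % Wnat V γ q = r}

/-- `iterCycle π k` is the cycle `π` iterated `k+1` times. -/
def iterCycle (π : List Q) : ℕ → List Q
  | 0 => π
  | k + 1 => iterCycle π k ++ π.tail

/-- Counter values `z < z'` at state `q` are connected by a valid run iterating `γ q`. -/
def chainLinked (V : OneVASS Q) (γ : Q → List Q) (q : Q) (z z' : ℕ) : Prop :=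
  ∃ k, IsValidRun V (iterCycle (γ q) k) z ∧
    (z' : ℤ) = (z : ℤ) + pathWeight V (iterCycle (γ q) k)

/-- Any two configurations of `S` are connected by iterating `γ q`. -/
def ChainCond (V : OneVASS Q) (γ : Q → List Q) (q : Q) (S : Set (Q × ℕ)) : Prop :=
  ∀ c ∈ S, ∀ c' ∈ S, c.2 < c'.2 → chainLinked V γ q c.2 c'.2

/-- A `q`-chain inside the `q`-residue class of `r`: a maximal subset whose
configurations are pairwise connected by iterating `γ q`. -/
def IsChainIn (V : OneVASS Q) (γ : Q → List Q) (q : Q) (r : ℕ) (C : Set (Q × ℕ)) : Prop :=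
  C ⊆ resClass V γ q r ∧ ChainCond V γ q C ∧
    ∀ C', C ⊆ C' → C' ⊆ resClass V γ q r → ChainCond V γ q C' → C' = C

/-- A chain (in some residue class of some state of `Q₊`). -/
def IsChain (V : OneVASS Q) (γ : Q → List Q) (C : Set (Q × ℕ)) : Prop :=
  ∃ q r, q ∈ Qplus V ∧ r < Wnat V γ q ∧ IsChainIn V γ q r C

/-- A set of configurations is bounded if its counter values are bounded. -/
def chainBounded (C : Set (Q × ℕ)) : Prop :=
  BddAbove (Prod.snd '' C)

/-- A residue class is trivial if it consists of a single unbounded chain. -/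
def TrivialClass (V : OneVASS Q) (γ : Q → List Q) (q : Q) (r : ℕ) : Prop :=
  IsChainIn V γ q r (resClass V γ q r) ∧ ¬ chainBounded (resClass V γ q r)

/-- There is a valid run of length `k` (i.e. `k` transitions) from `c` into the set `S`. -/
def RunLenTo (V : OneVASS Q) (c : Q × ℕ) (S : Set (Q × ℕ)) (k : ℕ) : Prop :=
  ∃ π c', c' ∈ S ∧ IsValidRun V π c.2 ∧ RunFromTo V π c c' ∧ π.length = k + 1

/-- Configurations of `Conf₊ \ Un` whose distance to `Un` is minimal among all
configurations of `Conf₊ \ Un`. -/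
def Uprime (V : OneVASS Q) (γ : Q → List Q) (Un : Set (Q × ℕ)) : Set (Q × ℕ) :=
  {c | c ∈ ConfPlus V γ \ Un ∧
    ∃ k, RunLenTo V c Un k ∧
      ∀ c' ∈ ConfPlus V γ \ Un, ∀ j, RunLenTo V c' Un j → k ≤ j}

/-- `S` is downward closed in every chain. -/
def dcClosed (V : OneVASS Q) (γ : Q → List Q) (S : Set (Q × ℕ)) : Prop :=
  ∀ C, IsChain V γ C → ∀ c ∈ S ∩ C, ∀ c' ∈ C, c'.2 ≤ c.2 → c' ∈ S

/-- The inductive sequence `U_n`: `U_0` is the union of the unbounded chains; `U_{n+1}` is the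
smallest superset of `U_n ∪ U'_n` that is downward closed in every chain. -/
def U (V : OneVASS Q) (γ : Q → List Q) : ℕ → Set (Q × ℕ)
  | 0 => ⋃₀ {C | IsChain V γ C ∧ ¬ chainBounded C}
  | n + 1 => ⋂₀ {S | U V γ n ∪ Uprime V γ (U V γ n) ⊆ S ∧ dcClosed V γ S}

/-- `C` is an `n`-active bounded chain in the `q`-residue class of `r`. -/
def nActiveIn (V : OneVASS Q) (γ : Q → List Q) (q : Q) (r : ℕ) (n : ℕ)
    (C : Set (Q × ℕ)) : Prop :=
  IsChainIn V γ q r C ∧ chainBounded C ∧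
    ∃ c ∈ U V γ n ∩ resClass V γ q r, ∃ c' ∈ C, c.2 ≤ c'.2

/-- `δ_n(C)` for a `q`-chain `C`: configurations outside `U_n` whose counter value lies
between two counter values of `C \ U_n`. -/
def deltaC (V : OneVASS Q) (γ : Q → List Q) (n : ℕ) (q : Q) (C : Set (Q × ℕ)) :
    Set (Q × ℕ) :=
  {c | c ∈ ConfPlus V γ ∧ c.1 = q ∧ c ∉ U V γ n ∧
    ∃ z₁ z₂, (q, z₁) ∈ C \ U V γ n ∧ (q, z₂) ∈ C \ U V γ n ∧ z₁ ≤ c.2 ∧ c.2 ≤ z₂}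

/-- `δ_n(R)` for the `q`-residue class `R` of `r`: union of `δ_n(C)` over `n`-active chains. -/
def deltaR (V : OneVASS Q) (γ : Q → List Q) (n : ℕ) (q : Q) (r : ℕ) : Set (Q × ℕ) :=
  {c | ∃ C, nActiveIn V γ q r n C ∧ c ∈ deltaC V γ n q C}

/-- A positive-weight cycle (as a list of states). -/
def IsPosCycle (V : OneVASS Q) (π : List Q) : Prop :=
  2 ≤ π.length ∧ π.head? = π.getLast? ∧ 0 < pathWeight V π

/-- A path is primitive if no proper infix of it is a positive-weight cycle. -/
def Primitive (V : OneVASS Q) (π : List Q) : Prop :=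
  ∀ i l, (π.drop i).take l ≠ π → ¬ IsPosCycle V ((π.drop i).take l)


/-! ### Paths and runs -/

theorem pathWeight_cons_cons (V : OneVASS Q) (a b : Q) (l : List Q) :
    pathWeight V (a :: b :: l) = V.w a b + pathWeight V (b :: l) := by
  simp [pathWeight]

@[simp] theorem pathWeight_singleton (V : OneVASS Q) (a : Q) : pathWeight V [a] = 0 := by
  simp [pathWeight]

@[simp] theorem pathWeight_nil (V : OneVASS Q) : pathWeight V [] = 0 := by
  simp [pathWeight]

theorem pathWeight_append_cons (V : OneVASS Q) (A : List Q) (p : Q) (B : List Q) :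
    pathWeight V (A ++ p :: B) = pathWeight V (A ++ [p]) + pathWeight V (p :: B) := by
  induction A with
  | nil => simp
  | cons a A ih =>
    cases A with
    | nil => simp [pathWeight_cons_cons]
    | cons b A =>
      simp only [List.cons_append, pathWeight_cons_cons] at ih ⊢
      rw [ih]; ring

theorem isPath_iff (V : OneVASS Q) (l : List Q) :
    IsPath V l ↔ l ≠ [] ∧ List.IsChain V.delta l := by
  induction l with
  | nil => simp [IsPath]
  | cons a l ih =>
    cases l with
    | nil => simp [IsPath]
    | cons b l => simp [IsPath, ih]

/-- Valid runs, described by recursion on the path. -/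
def ValidFrom (V : OneVASS Q) : List Q → ℤ → Prop
  | [], _ => False
  | [p], z => 0 ≤ z ∧ z.toNat ∈ V.D p
  | p :: p' :: l, z =>
    (0 ≤ z ∧ z.toNat ∈ V.D p) ∧ V.delta p p' ∧ ValidFrom V (p' :: l) (z + V.w p p')

theorem validFrom_iff (V : OneVASS Q) (π : List Q) (z : ℤ) :
    ValidFrom V π z ↔ IsPath V π ∧ ∀ i, ∀ h : i < π.length,
      0 ≤ z + pathWeight V (π.take (i + 1)) ∧
        (z + pathWeight V (π.take (i + 1))).toNat ∈ V.D (π.get ⟨i, h⟩) := by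
  induction π generalizing z with
  | nil => simp [ValidFrom, IsPath]
  | cons p l ih =>
    cases l with
    | nil => simp [ValidFrom, IsPath]
    | cons p' l =>
      rw [ValidFrom, ih, IsPath]
      constructor
      · rintro ⟨h0, hd, hp, hi⟩
        refine ⟨⟨hd, hp⟩, fun i h => ?_⟩
        cases i with
        | zero => simpa using h0
        | succ i =>
          have := hi i (by simpa using h)
          simpa [pathWeight_cons_cons, add_assoc] using this
      · rintro ⟨⟨hd, hp⟩, hi⟩
        refine ⟨by simpa using hi 0 (by simp), hd, hp, fun i h => ?_⟩
        have := hi (i + 1) (by simpa using h)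
        simpa [pathWeight_cons_cons, add_assoc] using this

theorem isValidRun_iff (V : OneVASS Q) (π : List Q) (z : ℕ) :
    IsValidRun V π z ↔ ValidFrom V π z := by
  rw [validFrom_iff, IsValidRun, IsRun]
  unfold counterAt
  constructor
  · rintro ⟨⟨h1, h2⟩, h3⟩
    exact ⟨h1, fun i h => ⟨h2 i h, h3 i h⟩⟩
  · rintro ⟨h1, h2⟩
    exact ⟨⟨h1, fun i h => (h2 i h).1⟩, fun i h => (h2 i h).2⟩

theorem validFrom_append_cons (V : OneVASS Q) (A : List Q) (p : Q) (B : List Q) (z : ℤ) :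
    ValidFrom V (A ++ p :: B) z ↔
      ValidFrom V (A ++ [p]) z ∧ ValidFrom V (p :: B) (z + pathWeight V (A ++ [p])) := by
  induction A generalizing z with
  | nil =>
    simp only [List.nil_append, pathWeight_singleton, add_zero]
    cases B <;> simp [ValidFrom]
  | cons a A ih =>
    cases A with
    | nil =>
      simp only [List.nil_append, List.cons_append, ValidFrom, pathWeight_cons_cons,
        pathWeight_singleton, add_zero]
      cases B <;> simp [ValidFrom]
      tauto
    | cons b A =>
      simp only [List.cons_append, ValidFrom, pathWeight_cons_cons] at ih ⊢
      rw [ih, add_assoc]; tauto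

theorem foldr_min_le (l : List ℤ) : l.foldr min 0 ≤ 0 ∧ ∀ x ∈ l, l.foldr min 0 ≤ x := by
  induction l with
  | nil => simp
  | cons a l ih =>
    simp only [List.foldr_cons, List.mem_cons, forall_eq_or_imp]
    exact ⟨(min_le_right _ _).trans ih.1, min_le_left _ _,
      fun x hx => (min_le_right _ _).trans (ih.2 x hx)⟩

theorem le_foldr_min (l : List ℤ) (b : ℤ) (h0 : b ≤ 0) (h : ∀ x ∈ l, b ≤ x) :
    b ≤ l.foldr min 0 := by
  induction l with
  | nil => simpa
  | cons a l ih =>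
    simp only [List.mem_cons, forall_eq_or_imp] at h
    exact le_min h.1 (ih h.2)

theorem pmin_nonneg_iff (V : OneVASS Q) (π : List Q) (z : ℕ) :
    0 ≤ (z : ℤ) + pmin V π ↔ ∀ i, i < π.length → 0 ≤ counterAt V z π i := by
  unfold pmin counterAt
  constructor
  · intro h i hi
    have := (foldr_min_le ((List.range (π.length + 1)).map fun i => pathWeight V (π.take i))).2
      (pathWeight V (π.take (i + 1))) (List.mem_map.2 ⟨i + 1, by simpa using hi, rfl⟩)
    linarith
  · intro h
    have := le_foldr_min ((List.range (π.length + 1)).map fun i => pathWeight V (π.take i))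
      (-(z : ℤ)) (by simp) (by
        intro x hx
        obtain ⟨i, hi, rfl⟩ := List.mem_map.1 hx
        cases i with
        | zero => simp
        | succ i =>
          have := h i (by simpa using hi)
          linarith)
    linarith

theorem isRun_mono (V : OneVASS Q) (π : List Q) {z y : ℕ} (h : IsRun V π z) (hy : z ≤ y) :
    IsRun V π y := by
  refine ⟨h.1, fun i hi => (h.2 i hi).trans ?_⟩
  unfold counterAt
  have : (z : ℤ) ≤ y := by exact_mod_cast hy
  linarith

/-- A path along which counter values stay nonnegative from `z` is blocked by disequality guards
from at most `π.length` starting values `y ≥ z`. -/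
theorem exists_finset_blocked (V : OneVASS Q) (hV : SingleGuard V) (π : List Q) (z : ℕ)
    (h : IsRun V π z) :
    ∃ F : Finset ℕ, F.card ≤ π.length ∧ ∀ y, z ≤ y → ¬ IsValidRun V π y → y ∈ F := by
  classical
  have key : ∀ i : Fin π.length, ∃ b : ℕ, ∀ y, z ≤ y →
      (counterAt V y π i).toNat ∉ V.D (π.get i) → y = b := by
    intro i
    rcases hV (π.get i) with hg | ⟨g, hg⟩
    · exact ⟨0, fun y _ hy => absurd (by rw [hg]; trivial) hy⟩
    · refine ⟨((g : ℤ) - pathWeight V (π.take (i + 1))).toNat, fun y hzy hy => ?_⟩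
      have h1 := (isRun_mono V π h hzy).2 i i.2
      rw [hg, Set.mem_compl_iff, not_not, Set.mem_singleton_iff] at hy
      unfold counterAt at h1 hy
      omega
  choose f hf using key
  refine ⟨Finset.univ.image f, Finset.card_image_le.trans (by simp), fun y hzy hy => ?_⟩
  have : ∃ i : Fin π.length, (counterAt V y π i).toNat ∉ V.D (π.get i) := by
    by_contra! hc
    exact hy ⟨isRun_mono V π h hzy, fun i hi => hc ⟨i, hi⟩⟩
  obtain ⟨i, hi⟩ := this
  rw [hf i y hzy hi]
  exact Finset.mem_image_of_mem _ (Finset.mem_univ _)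

/-! ### Chains -/

theorem iterCycle_spec (V : OneVASS Q) {π : List Q} {q : Q} (h : IsCycleOn V π q) (k : ℕ) :
    (∃ A, iterCycle π k = A ++ [q]) ∧
    pathWeight V (iterCycle π k) = (k + 1) * pathWeight V π ∧
    ∀ z : ℤ, ValidFrom V (iterCycle π k) z ↔
      ∀ i : ℕ, i ≤ k → ValidFrom V π (z + i * pathWeight V π) := by
  obtain ⟨-, -, hh, hl⟩ := h
  obtain ⟨t, ht⟩ := List.head?_eq_some_iff.1 hh
  obtain ⟨A', hA'⟩ := List.getLast?_eq_some_iff.1 hl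
  induction k with
  | zero => exact ⟨⟨A', hA'⟩, by simp [iterCycle], by simp [iterCycle]⟩
  | succ k ih =>
    obtain ⟨⟨A, hA⟩, hw, hv⟩ := ih
    have e : iterCycle π (k + 1) = A ++ q :: t := by
      rw [iterCycle, hA, ht]; simp
    refine ⟨⟨A ++ A', by rw [e, ← ht, hA']; simp⟩, ?_, fun z => ?_⟩
    · rw [e, pathWeight_append_cons, ← ht, ← hA, hw]
      push_cast; ring
    · rw [e, validFrom_append_cons, ← ht, ← hA, hw, hv]
      constructor
      · rintro ⟨h1, h2⟩ i hi
        rcases Nat.le_succ_iff.1 hi with hi | rfl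
        · exact h1 i hi
        · simpa using h2
      · intro h1
        exact ⟨fun i hi => h1 i (by omega), by simpa using h1 (k + 1) le_rfl⟩

/-- `a ≤ b` are congruent modulo `W_q`, and iterating `γ q` from `(q, a)` is valid up to
`(q, b)`. -/
def Linked (V : OneVASS Q) (γ : Q → List Q) (q : Q) (a b : ℕ) : Prop :=
  a ≤ b ∧ a ≡ b [MOD Wnat V γ q] ∧
    ∀ y, a ≤ y → y < b → y ≡ a [MOD Wnat V γ q] → IsValidRun V (γ q) y

section Chains

variable {V : OneVASS Q} {γ : Q → List Q} {q : Q}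

theorem Linked.refl (a : ℕ) : Linked V γ q a a :=
  ⟨le_rfl, rfl, fun _ h1 h2 => absurd h1 (by omega)⟩

theorem Linked.trans {a b c : ℕ} (h1 : Linked V γ q a b) (h2 : Linked V γ q b c) :
    Linked V γ q a c := by
  refine ⟨h1.1.trans h2.1, h1.2.1.trans h2.2.1, fun y ha hc hm => ?_⟩
  rcases lt_or_ge y b with h | h
  · exact h1.2.2 y ha h hm
  · exact h2.2.2 y h hc (hm.trans h1.2.1)

theorem Linked.sub {a b c d : ℕ} (h : Linked V γ q a d) (hab : a ≤ b) (hbc : b ≤ c) (hcd : c ≤ d)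
    (hb : b ≡ a [MOD Wnat V γ q]) (hc : c ≡ a [MOD Wnat V γ q]) : Linked V γ q b c :=
  ⟨hbc, hb.trans hc.symm, fun y h1 h2 h3 => h.2.2 y (by omega) (by omega) (h3.trans hb)⟩

theorem wnat_pos (hγ : GammaChoice V γ) (hq : q ∈ Qplus V) : 0 < Wnat V γ q := by
  have := (hγ q hq).2.1
  unfold Wnat; omega

theorem wnat_cast (hγ : GammaChoice V γ) (hq : q ∈ Qplus V) :
    (Wnat V γ q : ℤ) = pathWeight V (γ q) := by
  have := (hγ q hq).2.1
  unfold Wnat; omega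

theorem chainLinked_iff (hγ : GammaChoice V γ) (hq : q ∈ Qplus V) {a b : ℕ} :
    chainLinked V γ q a b ↔ a < b ∧ Linked V γ q a b := by
  have hW := wnat_pos hγ hq
  have hWc := wnat_cast hγ hq
  have hs := iterCycle_spec V (hγ q hq).1.1
  unfold chainLinked Linked
  constructor
  · rintro ⟨k, hk, hb⟩
    rw [isValidRun_iff, (hs k).2.2] at hk
    rw [(hs k).2.1, ← hWc] at hb
    have hb' : b = a + (k + 1) * Wnat V γ q := by exact_mod_cast hb
    have hpos : 0 < (k + 1) * Wnat V γ q := by positivity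
    refine ⟨by omega, by omega, ?_, fun y h1 h2 h3 => ?_⟩
    · rw [hb']; simp [Nat.ModEq]
    · obtain ⟨i, hi⟩ := (Nat.modEq_iff_dvd' h1).1 h3.symm
      have hy : y = a + i * Wnat V γ q := by rw [mul_comm]; omega
      have hik : i ≤ k := by
        have : i * Wnat V γ q < (k + 1) * Wnat V γ q := by omega
        have := Nat.lt_of_mul_lt_mul_right this
        omega
      rw [isValidRun_iff, hy]
      have := hk i hik
      rw [← hWc] at this
      exact_mod_cast this
  · rintro ⟨hlt, hle, hmod, hv⟩
    obtain ⟨i, hi⟩ := (Nat.modEq_iff_dvd' hle).1 hmod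
    cases i with
    | zero => omega
    | succ k =>
      have hb : b = a + (k + 1) * Wnat V γ q := by rw [mul_comm]; omega
      refine ⟨k, ?_, ?_⟩
      · rw [isValidRun_iff, (hs k).2.2]
        intro i hi
        have h1 : i * Wnat V γ q < (k + 1) * Wnat V γ q :=
          Nat.mul_lt_mul_of_pos_right (by omega) hW
        have := hv (a + i * Wnat V γ q) (by omega) (by omega) (by simp [Nat.ModEq])
        rw [isValidRun_iff] at this
        rw [← hWc]
        exact_mod_cast this
      · rw [(hs k).2.1, ← hWc, hb]; push_cast; ring

theorem confPlus_mono {a b : ℕ} (h : (q, a) ∈ ConfPlus V γ) (hab : a ≤ b) :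
    (q, b) ∈ ConfPlus V γ := by
  refine ⟨h.1, ?_⟩
  have := h.2
  dsimp only at this ⊢
  omega

theorem isChain_subset_confPlus {C : Set (Q × ℕ)} (hC : IsChain V γ C) : C ⊆ ConfPlus V γ := by
  obtain ⟨q, r, -, -, h⟩ := hC
  exact fun c hc => (h.1 hc).1

theorem IsChainIn.linked (hγ : GammaChoice V γ) (hq : q ∈ Qplus V) {r : ℕ} {C : Set (Q × ℕ)}
    (hC : IsChainIn V γ q r C) {c c' : Q × ℕ} (hc : c ∈ C) (hc' : c' ∈ C) (h : c.2 ≤ c'.2) :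
    Linked V γ q c.2 c'.2 := by
  rcases h.eq_or_lt with h | h
  · rw [h]; exact Linked.refl _
  · exact ((chainLinked_iff hγ hq).1 (hC.2.1 c hc c' hc' h)).2

/-- The chain containing the configuration `(q, x)`. -/
def chainOf (V : OneVASS Q) (γ : Q → List Q) (q : Q) (x : ℕ) : Set (Q × ℕ) :=
  {c | c ∈ resClass V γ q (x % Wnat V γ q) ∧ (Linked V γ q x c.2 ∨ Linked V γ q c.2 x)}

theorem mem_chainOf_self {x : ℕ} (hx : (q, x) ∈ ConfPlus V γ) : (q, x) ∈ chainOf V γ q x :=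
  ⟨⟨hx, rfl, rfl⟩, Or.inl (Linked.refl _)⟩

theorem IsChainIn.subset_chainOf (hγ : GammaChoice V γ) (hq : q ∈ Qplus V) {r x : ℕ}
    {C : Set (Q × ℕ)} (hC : IsChainIn V γ q r C) (hx : (q, x) ∈ C) : C ⊆ chainOf V γ q x := by
  intro c hc
  refine ⟨?_, ?_⟩
  · have h1 := hC.1 hx
    have h2 := hC.1 hc
    exact ⟨h2.1, h2.2.1, h2.2.2.trans h1.2.2.symm⟩
  · rcases le_total x c.2 with h | h
    · exact Or.inl (hC.linked hγ hq hx hc h)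
    · exact Or.inr (hC.linked hγ hq hc hx h)

theorem chainCond_chainOf (hγ : GammaChoice V γ) (hq : q ∈ Qplus V) (x : ℕ) :
    ChainCond V γ q (chainOf V γ q x) := by
  intro c hc c' hc' hlt
  rw [chainLinked_iff hγ hq]
  refine ⟨hlt, ?_⟩
  obtain ⟨-, hc⟩ := hc
  obtain ⟨-, hc'⟩ := hc'
  rcases hc with hc | hc <;> rcases hc' with hc' | hc'
  · exact hc'.sub hc.1 hlt.le le_rfl hc.2.1.symm hc'.2.1.symm
  · exact absurd hlt (by have := hc.1; have := hc'.1; omega)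
  · exact hc.trans hc'
  · exact hc.sub le_rfl hlt.le hc'.1 rfl (hc'.2.1.trans hc.2.1.symm)

theorem isChainIn_chainOf (hγ : GammaChoice V γ) {x : ℕ} (hx : (q, x) ∈ ConfPlus V γ) :
    IsChainIn V γ q (x % Wnat V γ q) (chainOf V γ q x) := by
  have hq : q ∈ Qplus V := hx.1
  refine ⟨fun c hc => hc.1, chainCond_chainOf hγ hq x, fun C' h1 h2 h3 => ?_⟩
  refine Set.Subset.antisymm (fun c hc => ⟨h2 hc, ?_⟩) h1
  have hxC := h1 (mem_chainOf_self hx)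
  rcases lt_trichotomy x c.2 with h | h | h
  · exact Or.inl ((chainLinked_iff hγ hq).1 (h3 _ hxC _ hc h)).2
  · left; rw [h]; exact Linked.refl _
  · exact Or.inr ((chainLinked_iff hγ hq).1 (h3 _ hc _ hxC h)).2

theorem IsChainIn.eq_chainOf (hγ : GammaChoice V γ) (hq : q ∈ Qplus V) {r x : ℕ}
    {C : Set (Q × ℕ)} (hC : IsChainIn V γ q r C) (hx : (q, x) ∈ C) : chainOf V γ q x = C := by
  have hr : x % Wnat V γ q = r := (hC.1 hx).2.2
  refine hC.2.2 _ (hC.subset_chainOf hγ hq hx) (fun c hc => ?_) (chainCond_chainOf hγ hq x)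
  rw [← hr]
  exact hc.1

theorem isChain_chainOf (hγ : GammaChoice V γ) {x : ℕ} (hx : (q, x) ∈ ConfPlus V γ) :
    IsChain V γ (chainOf V γ q x) :=
  ⟨q, _, hx.1, Nat.mod_lt _ (wnat_pos hγ hx.1), isChainIn_chainOf hγ hx⟩

/-! ### The sets `U n` -/

theorem U_subset_succ (n : ℕ) : U V γ n ∪ Uprime V γ (U V γ n) ⊆ U V γ (n + 1) :=
  Set.subset_sInter fun _ hS => hS.1

theorem U_mono {m n : ℕ} (h : m ≤ n) : U V γ m ⊆ U V γ n := by
  induction h with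
  | refl => rfl
  | step _ ih => exact ih.trans (Set.subset_union_left.trans (U_subset_succ _))

theorem U_succ_dcClosed (n : ℕ) : dcClosed V γ (U V γ (n + 1)) := by
  rintro C hC c ⟨hc, hcC⟩ c' hc' hle S hS
  exact hS.2 C hC c ⟨hc S hS, hcC⟩ c' hc' hle

theorem U_succ_of_linked (hγ : GammaChoice V γ) {n a u : ℕ} (ha : (q, a) ∈ ConfPlus V γ)
    (h : Linked V γ q a u) (hu : (q, u) ∈ U V γ (n + 1)) : (q, a) ∈ U V γ (n + 1) :=
  U_succ_dcClosed n _ (isChain_chainOf hγ ha) (q, u)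
    ⟨hu, ⟨confPlus_mono ha h.1, rfl, h.2.1.symm⟩, Or.inl h⟩ _ (mem_chainOf_self ha) h.1

theorem U_zero_subset_confPlus : U V γ 0 ⊆ ConfPlus V γ := by
  rintro c ⟨C, ⟨hC, -⟩, hc⟩
  exact isChain_subset_confPlus hC hc

theorem U_subset_confPlus (n : ℕ) : U V γ n ⊆ ConfPlus V γ := by
  induction n with
  | zero => exact U_zero_subset_confPlus
  | succ n ih =>
    apply Set.sInter_subset_of_mem
    refine ⟨Set.union_subset ih fun c hc => hc.1.1, ?_⟩
    intro C hC c hc c' hc' _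
    exact isChain_subset_confPlus hC hc'

theorem exists_linked_of_mem_U_succ (hγ : GammaChoice V γ) {n c : ℕ}
    (hc : (q, c) ∈ U V γ (n + 1)) :
    ∃ u, (q, u) ∈ U V γ n ∪ Uprime V γ (U V γ n) ∧ Linked V γ q c u := by
  refine hc {c | ∃ u, (c.1, u) ∈ U V γ n ∪ Uprime V γ (U V γ n) ∧ Linked V γ c.1 c.2 u}
    ⟨fun c hc => ⟨c.2, hc, Linked.refl _⟩, ?_⟩
  rintro C ⟨p, r, hp, -, hC⟩ c ⟨⟨u, hu, hl⟩, hcC⟩ c' hc' hle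
  have h1 : c.1 = p := (hC.1 hcC).2.1
  have h2 : c'.1 = p := (hC.1 hc').2.1
  have h3 := hC.linked hγ hp hc' hcC hle
  refine ⟨u, by rw [h2, ← h1]; exact hu, ?_⟩
  rw [h1] at hl
  rw [h2]
  exact h3.trans hl

theorem chainBounded_chainOf (hγ : GammaChoice V γ) {x : ℕ} (hx : (q, x) ∈ ConfPlus V γ)
    (h : (q, x) ∉ U V γ 0) : chainBounded (chainOf V γ q x) := by
  by_contra hb
  exact h ⟨_, ⟨isChain_chainOf hγ hx, hb⟩, mem_chainOf_self hx⟩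

theorem exists_blocked_of_notMem_U_zero (hγ : GammaChoice V γ) {x : ℕ}
    (hx : (q, x) ∈ ConfPlus V γ) (h : (q, x) ∉ U V γ 0) :
    ∃ b, Linked V γ q x b ∧ ¬ IsValidRun V (γ q) b := by
  classical
  have hW := wnat_pos hγ hx.1
  have key : ∃ b, x ≤ b ∧ b ≡ x [MOD Wnat V γ q] ∧ ¬ IsValidRun V (γ q) b := by
    by_contra! hc
    obtain ⟨M, hM⟩ := chainBounded_chainOf hγ hx h
    have hmod : x + (M + 1) * Wnat V γ q ≡ x [MOD Wnat V γ q] := by simp [Nat.ModEq]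
    have hmem : (q, x + (M + 1) * Wnat V γ q) ∈ chainOf V γ q x :=
      ⟨⟨confPlus_mono hx (by omega), rfl, hmod⟩,
        Or.inl ⟨by simp, hmod.symm, fun y h1 _ h3 => hc y h1 h3⟩⟩
    have h1 : x + (M + 1) * Wnat V γ q ≤ M := hM ⟨_, hmem, rfl⟩
    have h2 : M + 1 ≤ (M + 1) * Wnat V γ q := Nat.le_mul_of_pos_right _ hW
    omega
  obtain ⟨h1, h2, h3⟩ := Nat.find_spec key
  refine ⟨Nat.find key, ⟨h1, h2.symm, fun y hy1 hy2 hy3 => ?_⟩, h3⟩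
  by_contra hy
  exact Nat.find_min key hy2 ⟨hy1, hy3, hy⟩

theorem length_le_of_simpleCycle [Fintype Q] {π : List Q} (h : IsSimpleCycleOn V π q) :
    π.length ≤ Fintype.card Q + 1 := by
  have := h.2.length_le_card
  rw [List.length_dropLast] at this
  omega

theorem exists_finset_gamma_blocked [Fintype Q] (hV : SingleGuard V) (hγ : GammaChoice V γ)
    (hq : q ∈ Qplus V) :
    ∃ B : Finset ℕ, B.card ≤ Fintype.card Q + 1 ∧
      ∀ y, (q, y) ∈ ConfPlus V γ → ¬ IsValidRun V (γ q) y → y ∈ B := by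
  have h := (hγ q hq).1
  have key : IsRun V (γ q) (-pmin V (γ q)).toNat :=
    ⟨h.1.1, (pmin_nonneg_iff V _ _).1 (by omega)⟩
  obtain ⟨B, hB, hB'⟩ := exists_finset_blocked V hV _ _ key
  refine ⟨B, hB.trans (length_le_of_simpleCycle h), fun y hy hn => hB' y ?_ hn⟩
  have := hy.2
  dsimp only at this
  omega

end Chains

/-! ### Lossy runs -/

/-- A transition after which the counter may have dropped below its exact value. -/
def LossyStep (V : OneVASS Q) (c d : Q × ℕ) : Prop :=
  V.delta c.1 d.1 ∧ (d.2 : ℤ) ≤ c.2 + V.w c.1 d.1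

/-- `c, N, d` is a lossy run whose intermediate configurations `N` lie outside `Conf₊`. -/
def LossyRun (V : OneVASS Q) (γ : Q → List Q) (c : Q × ℕ) (N : List (Q × ℕ)) (d : Q × ℕ) : Prop :=
  List.IsChain (LossyStep V) (c :: (N ++ [d])) ∧ ∀ e ∈ N, e ∉ ConfPlus V γ

/-- The path underlying a lossy run. -/
def lossyPath (c : Q × ℕ) (N : List (Q × ℕ)) (d : Q × ℕ) : List Q :=
  c.1 :: (N.map Prod.fst ++ [d.1])

section Lossy

variable {V : OneVASS Q} {γ : Q → List Q}

theorem lossy_getElem_le {c : Q × ℕ} {l : List (Q × ℕ)}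
    (h : List.IsChain (LossyStep V) (c :: l)) (i : ℕ) (hi : i < (c :: l).length) :
    (((c :: l)[i]).2 : ℤ) ≤ c.2 + pathWeight V (((c :: l).map Prod.fst).take (i + 1)) := by
  induction l generalizing c i with
  | nil =>
    obtain rfl : i = 0 := by simpa using hi
    simp
  | cons d l ih =>
    rw [List.isChain_cons_cons] at h
    cases i with
    | zero => simp
    | succ i =>
      have := ih h.2 i (by simpa using hi)
      have h1 := h.1.2
      simp only [List.map_cons, List.take_succ_cons, List.getElem_cons_succ,
        pathWeight_cons_cons] at this ⊢
      linarith

theorem LossyRun.isRun {c d : Q × ℕ} {N : List (Q × ℕ)} (h : LossyRun V γ c N d) :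
    IsRun V (lossyPath c N d) c.2 := by
  have e : lossyPath c N d = (c :: (N ++ [d])).map Prod.fst := by simp [lossyPath]
  rw [e]
  refine ⟨(isPath_iff _ _).2 ⟨by simp, ?_⟩, fun i hi => ?_⟩
  · rw [List.isChain_map]
    exact h.1.imp fun _ _ h => h.1
  · have := lossy_getElem_le h.1 i (by simpa using hi)
    unfold counterAt
    omega

theorem LossyRun.le_weight {c d : Q × ℕ} {N : List (Q × ℕ)} (h : LossyRun V γ c N d) :
    (d.2 : ℤ) ≤ c.2 + pathWeight V (lossyPath c N d) := by
  have := lossy_getElem_le h.1 (N.length + 1) (by simp)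
  rw [List.take_of_length_le (by simp)] at this
  simpa [lossyPath] using this

theorem lossy_cons_mono {p : Q} {a b : ℕ} {l : List (Q × ℕ)} (hab : b ≤ a)
    (h : List.IsChain (LossyStep V) ((p, b) :: l)) : List.IsChain (LossyStep V) ((p, a) :: l) := by
  cases l with
  | nil => simp
  | cons d l =>
    rw [List.isChain_cons_cons] at h ⊢
    refine ⟨⟨h.1.1, h.1.2.trans ?_⟩, h.2⟩
    simp; exact hab

theorem isChain_cons_append_cons {α : Type*} {R : α → α → Prop} {c x : α} {A B : List α} :
    List.IsChain R (c :: (A ++ x :: B)) ↔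
      List.IsChain R (c :: (A ++ [x])) ∧ List.IsChain R (x :: B) := by
  rw [← List.cons_append, List.isChain_split, List.cons_append]

theorem lossyRun_append_cons {c d x : Q × ℕ} {A B : List (Q × ℕ)} :
    LossyRun V γ c (A ++ x :: B) d ↔
      LossyRun V γ c A x ∧ LossyRun V γ x B d ∧ x ∉ ConfPlus V γ := by
  unfold LossyRun
  rw [List.append_assoc, List.cons_append, isChain_cons_append_cons]
  simp only [List.mem_append, List.mem_cons]
  constructor
  · rintro ⟨⟨h1, h2⟩, h3⟩
    exact ⟨⟨h1, fun e he => h3 e (Or.inl he)⟩, ⟨h2, fun e he => h3 e (Or.inr (Or.inr he))⟩,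
      h3 x (Or.inr (Or.inl rfl))⟩
  · rintro ⟨⟨h1, h2⟩, ⟨h3, h4⟩, h5⟩
    refine ⟨⟨h1, h3⟩, ?_⟩
    rintro e (he | rfl | he)
    exacts [h2 e he, h5, h4 e he]

theorem LossyRun.raise {p : Q} {a b : ℕ} {d : Q × ℕ} {N : List (Q × ℕ)} (hab : b ≤ a)
    (h : LossyRun V γ (p, b) N d) : LossyRun V γ (p, a) N d :=
  ⟨lossy_cons_mono hab h.1, h.2⟩

theorem exists_decomp_of_not_nodup {X : List (Q × ℕ)} (h : ¬ (X.map Prod.fst).Nodup) :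
    ∃ A s x M y B, X = A ++ (s, x) :: (M ++ (s, y) :: B) := by
  induction X with
  | nil => simp at h
  | cons e X ih =>
    rw [List.map_cons, List.nodup_cons, not_and_or, not_not] at h
    by_cases he : e.1 ∈ X.map Prod.fst
    · obtain ⟨⟨s, y⟩, hf, hfe⟩ := List.mem_map.1 he
      obtain ⟨M, B, rfl⟩ := List.append_of_mem hf
      dsimp only at hfe
      subst hfe
      exact ⟨[], e.1, e.2, M, y, B, rfl⟩
    · obtain ⟨A, s, x, M, y, B, rfl⟩ := ih (h.resolve_left he)
      exact ⟨e :: A, s, x, M, y, B, rfl⟩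

/-- Outside `Conf₊`, lossy runs never increase the counter when they return to a state. -/
theorem LossyRun.loop_le (hγ : GammaChoice V γ) {p : Q} {a b : ℕ} {N : List (Q × ℕ)}
    (h : LossyRun V γ (p, a) N (p, b)) (hp : (p, a) ∉ ConfPlus V γ) : b ≤ a := by
  induction hn : N.length using Nat.strong_induction_on generalizing p a b N with
  | _ n ih =>
  subst hn
  by_contra! hlt
  have h1 : p ∉ N.map Prod.fst := by
    intro hmem
    obtain ⟨⟨p', c⟩, hc, hpp⟩ := List.mem_map.1 hmem
    dsimp only at hpp
    subst hpp
    obtain ⟨A, B, rfl⟩ := List.append_of_mem hc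
    obtain ⟨hA, hB, hx⟩ := lossyRun_append_cons.1 h
    have := ih A.length (by simp) hA hp rfl
    have := ih B.length (by simp; omega) hB hx rfl
    omega
  have h2 : (N.map Prod.fst).Nodup := by
    by_contra hnd
    obtain ⟨A, s, x, M, y, B, rfl⟩ := exists_decomp_of_not_nodup hnd
    obtain ⟨hA, hB, hx⟩ := lossyRun_append_cons.1 h
    obtain ⟨hM, hB, hy⟩ := lossyRun_append_cons.1 hB
    have hyx := ih M.length (by simp; omega) hM hx rfl
    have := ih (A ++ (s, x) :: B).length (by simp)
      (lossyRun_append_cons.2 ⟨hA, hB.raise hyx, hx⟩) hp rfl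
    omega
  have hw := h.le_weight
  have hr := h.isRun
  have hcyc : IsSimpleCycleOn V (lossyPath (p, a) N (p, b)) p := by
    refine ⟨⟨hr.1, by simp [lossyPath], by simp [lossyPath],
      by rw [lossyPath, ← List.cons_append]; exact List.getLast?_concat⟩, ?_⟩
    have : (lossyPath (p, a) N (p, b)).dropLast = p :: N.map Prod.fst := by
      rw [lossyPath, ← List.cons_append, List.dropLast_concat]
    rw [this, List.nodup_cons]
    exact ⟨h1, h2⟩
  have hpos : 0 < pathWeight V (lossyPath (p, a) N (p, b)) := by
    dsimp only at hw; omega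
  have hpq : p ∈ Qplus V := ⟨_, hcyc, hpos⟩
  have hmin := (hγ p hpq).2.2 _ hcyc hpos
  have := (pmin_nonneg_iff V _ _).2 hr.2
  exact hp ⟨hpq, by dsimp only at this ⊢; omega⟩

theorem LossyRun.exists_short [Fintype Q] (hγ : GammaChoice V γ) {c d : Q × ℕ} {N : List (Q × ℕ)}
    (h : LossyRun V γ c N d) :
    ∃ S, LossyRun V γ c S d ∧ S.length ≤ Fintype.card Q ∧ S.length ≤ N.length := by
  induction hn : N.length using Nat.strong_induction_on generalizing N with
  | _ n ih =>
  subst hn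
  by_cases hnd : (N.map Prod.fst).Nodup
  · exact ⟨N, h, by simpa using hnd.length_le_card, le_rfl⟩
  · obtain ⟨A, s, x, M, y, B, rfl⟩ := exists_decomp_of_not_nodup hnd
    obtain ⟨hA, hB, hx⟩ := lossyRun_append_cons.1 h
    obtain ⟨hM, hB, hy⟩ := lossyRun_append_cons.1 hB
    have hlen : (A ++ (s, x) :: B).length < (A ++ (s, x) :: (M ++ (s, y) :: B)).length := by simp
    obtain ⟨S, h1, h2, h3⟩ := ih _ hlen
      (lossyRun_append_cons.2 ⟨hA, hB.raise (hM.loop_le hγ hx), hx⟩) rfl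
    exact ⟨S, h1, h2, h3.trans hlen.le⟩

theorem pathWeight_lossyPath_append_cons (c d x : Q × ℕ) (A B : List (Q × ℕ)) :
    pathWeight V (lossyPath c (A ++ x :: B) d) =
      pathWeight V (lossyPath c A x) + pathWeight V (lossyPath x B d) := by
  have := pathWeight_append_cons V (c.1 :: A.map Prod.fst) x.1 (B.map Prod.fst ++ [d.1])
  simpa [lossyPath] using this

theorem pathWeight_lossyPath_congr {c c' d d' : Q × ℕ} (N : List (Q × ℕ)) (hc : c.1 = c'.1)
    (hd : d.1 = d'.1) :
    pathWeight V (lossyPath c N d) = pathWeight V (lossyPath c' N d') := by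
  simp [lossyPath, hc, hd]

theorem exists_decomp_of_lt {α : Type*} (N : List α) {i j : ℕ} (hij : i < j) (hj : j < N.length) :
    ∃ M, N = N.take i ++ N[i] :: (M ++ N[j] :: N.drop (j + 1)) ∧
      N.take j = N.take i ++ N[i] :: M := by
  have key : ∀ (L : List α) (k : ℕ) (hk : k < L.length),
      L = L.take k ++ L[k] :: L.drop (k + 1) := by
    intro L k hk
    simp
  have h1 := key N j hj
  have h2 := key (N.take j) i (by simp; omega)
  rw [List.take_take, min_eq_left hij.le, List.getElem_take] at h2
  refine ⟨(N.take j).drop (i + 1), ?_, h2⟩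
  conv_lhs => rw [h1, h2]
  simp

/-- A lossy run outside `Conf₊` can be shortened preserving its weight modulo `W`, or else there
are many short lossy runs with distinct weights modulo `W`. -/
theorem LossyRun.shorten_or_spread [Fintype Q] (hγ : GammaChoice V γ) (P : ℕ) (W : ℤ)
    {c d : Q × ℕ} {N₀ : List (Q × ℕ)} (h₀ : LossyRun V γ c N₀ d) :
    (∃ N, LossyRun V γ c N d ∧ N.length ≤ Fintype.card Q * P ∧ N.length ≤ N₀.length ∧
      pathWeight V (lossyPath c N d) ≡ pathWeight V (lossyPath c N₀ d) [ZMOD W]) ∨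
    ∃ (I : Finset ℕ) (F : ℕ → List (Q × ℕ)), I.card = P + 1 ∧
      (∀ i ∈ I, LossyRun V γ c (F i) d ∧ (F i).length ≤ Fintype.card Q * P + 1 + Fintype.card Q ∧
        (F i).length ≤ N₀.length) ∧
      ∀ i ∈ I, ∀ j ∈ I, pathWeight V (lossyPath c (F i) d) ≡
        pathWeight V (lossyPath c (F j) d) [ZMOD W] → i = j := by
  classical
  have hex : ∃ n, ∃ N, LossyRun V γ c N d ∧ N.length = n ∧ N.length ≤ N₀.length ∧
      pathWeight V (lossyPath c N d) ≡ pathWeight V (lossyPath c N₀ d) [ZMOD W] :=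
    ⟨_, N₀, h₀, rfl, le_rfl, rfl⟩
  obtain ⟨N, hN, hlen, hle, hmod⟩ := Nat.find_spec hex
  have hmin : ∀ N', LossyRun V γ c N' d →
      pathWeight V (lossyPath c N' d) ≡ pathWeight V (lossyPath c N d) [ZMOD W] →
      N.length ≤ N'.length := by
    intro N' h1 h2
    by_contra! hlt
    exact Nat.find_min hex (hlen ▸ hlt) ⟨N', h1, rfl, hlt.le.trans hle, h2.trans hmod⟩
  by_cases hP : N.length ≤ Fintype.card Q * P
  · exact Or.inl ⟨N, hN, hP, hle, hmod⟩
  right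
  push Not at hP
  -- prefixes of `N` reaching the same state have distinct weights modulo `W`
  have hpre : ∀ i j, (hij : i < j) → (hj : j < N.length) → N[i].1 = N[j].1 →
      N[j].2 ≤ N[i].2 ∧ ¬ pathWeight V (lossyPath c (N.take i) N[i]) ≡
        pathWeight V (lossyPath c (N.take j) N[j]) [ZMOD W] := by
    intro i j hij hj hs
    obtain ⟨M, hM, hM'⟩ := exists_decomp_of_lt N hij hj
    have hN' := hN
    rw [hM] at hN'
    obtain ⟨hA, hB, hx⟩ := lossyRun_append_cons.1 hN'
    obtain ⟨hC, hD, hy⟩ := lossyRun_append_cons.1 hB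
    have hle : N[j].2 ≤ N[i].2 := by
      have e : N[j] = (N[i].1, N[j].2) := by rw [hs]
      rw [e] at hC
      exact hC.loop_le hγ hx
    refine ⟨hle, fun hcon => ?_⟩
    have hD' : LossyRun V γ N[i] (N.drop (j + 1)) d := by
      have e : N[j] = (N[i].1, N[j].2) := by rw [hs]
      rw [e] at hD
      exact hD.raise hle
    have h1 := hmin _ (lossyRun_append_cons.2 ⟨hA, hD', hx⟩) (by
      have hNj : N = N.take j ++ N[j] :: N.drop (j + 1) := by simp
      conv_rhs => rw [hNj]
      rw [pathWeight_lossyPath_append_cons, pathWeight_lossyPath_append_cons,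
        pathWeight_lossyPath_congr (N.drop (j + 1)) hs rfl]
      exact hcon.add_right _)
    simp at h1
    omega
  obtain ⟨p, -, hp⟩ := Finset.exists_lt_card_fiber_of_mul_lt_card_of_maps_to
    (s := (Finset.univ : Finset (Fin (Fintype.card Q * P + 1)))) (t := (Finset.univ : Finset Q))
    (f := fun i => N[i.1].1) (n := P) (fun _ _ => Finset.mem_univ _)
    (by simp)
  obtain ⟨J, hJ, hJc⟩ := Finset.exists_subset_card_eq (Nat.succ_le_of_lt hp)
  have hJp : ∀ i ∈ J, N[i.1].1 = p := fun i hi => by simpa using hJ hi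
  have hJne : J.Nonempty := by rw [← Finset.card_pos, hJc]; omega
  obtain ⟨m, hmJ, hm⟩ : ∃ m ∈ J, ∀ i ∈ J, i ≤ m :=
    ⟨J.max' hJne, J.max'_mem _, fun i hi => J.le_max' i hi⟩
  have hml : m.1 < N.length := by have := m.2; omega
  have hsplit : ∀ i (hi : i < N.length), LossyRun V γ c (N.take i) N[i] ∧
      LossyRun V γ N[i] (N.drop (i + 1)) d ∧ N[i] ∉ ConfPlus V γ := by
    intro i hi
    rw [← lossyRun_append_cons]
    simpa using hN
  obtain ⟨S, hS, hS1, hS2⟩ := (hsplit m.1 hml).2.1.exists_short hγ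
  refine ⟨J.map Fin.valEmbedding, fun i => N.take (i + 1) ++ S, by simpa using hJc, ?_, ?_⟩
  · intro i hi
    obtain ⟨i, hiJ, rfl⟩ := Finset.mem_map.1 hi
    have hil : i.1 < N.length := by have := i.2; omega
    have him : i.1 ≤ m.1 := hm i hiJ
    have hst : N[i.1].1 = N[m.1].1 := (hJp i hiJ).trans (hJp m hmJ).symm
    have hval : N[m.1].2 ≤ N[i.1].2 := by
      rcases him.eq_or_lt with h | h
      · simp [h]
      · exact (hpre _ _ h hml hst).1
    have hS' : LossyRun V γ N[i.1] S d := by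
      have e : N[m.1] = (N[i.1].1, N[m.1].2) := by rw [hst]
      rw [e] at hS
      exact hS.raise hval
    have e : N.take (i.1 + 1) ++ S = N.take i.1 ++ N[i.1] :: S := by
      rw [List.take_succ_eq_append_getElem hil, List.append_assoc, List.singleton_append]
    refine ⟨?_, ?_, ?_⟩
    · simp only [Fin.valEmbedding_apply]
      rw [e]
      exact lossyRun_append_cons.2 ⟨(hsplit _ hil).1, hS', (hsplit _ hil).2.2⟩
    · simp; have := i.2; omega
    · simp at hS2 ⊢; omega
  · intro i hi j hj hw
    obtain ⟨i, hiJ, rfl⟩ := Finset.mem_map.1 hi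
    obtain ⟨j, hjJ, rfl⟩ := Finset.mem_map.1 hj
    have hil : i.1 < N.length := by have := i.2; omega
    have hjl : j.1 < N.length := by have := j.2; omega
    simp only [Fin.valEmbedding_apply] at hw ⊢
    have hst : N[i.1].1 = N[j.1].1 := (hJp i hiJ).trans (hJp j hjJ).symm
    have e : ∀ k (hk : k < N.length), N.take (k + 1) ++ S = N.take k ++ N[k] :: S := by
      intro k hk
      rw [List.take_succ_eq_append_getElem hk, List.append_assoc, List.singleton_append]
    rw [e _ hil, e _ hjl, pathWeight_lossyPath_append_cons, pathWeight_lossyPath_append_cons,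
      pathWeight_lossyPath_congr S hst rfl] at hw
    have hw' := Int.ModEq.add_right_cancel' _ hw
    rcases lt_trichotomy i.1 j.1 with h | h | h
    · exact absurd hw' (hpre _ _ h hjl hst).2
    · exact h
    · exact absurd hw'.symm (hpre _ _ h hil hst.symm).2

/-- The exact run over a path, as a lossy run. -/
theorem exists_lossyRun_of_validFrom {p p' : Q} {z z' : ℕ} {l : List Q}
    (hv : ValidFrom V (p :: (l ++ [p'])) z)
    (hz : (z' : ℤ) = z + pathWeight V (p :: (l ++ [p']))) :
    ∃ N : List (Q × ℕ), List.IsChain (LossyStep V) ((p, z) :: (N ++ [(p', z')])) ∧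
      N.map Prod.fst = l ∧ ∀ e ∈ N, ∃ A B, l = A ++ e.1 :: B ∧
        (e.2 : ℤ) = z + pathWeight V (p :: (A ++ [e.1])) := by
  induction l generalizing p z with
  | nil =>
    refine ⟨[], ?_, rfl, by simp⟩
    rw [List.nil_append, ValidFrom] at hv
    simp only [List.nil_append, pathWeight_cons_cons, pathWeight_singleton] at hz
    simp only [List.nil_append, List.isChain_cons_cons, List.isChain_singleton, and_true]
    exact ⟨hv.2.1, by dsimp only; omega⟩
  | cons s l ih =>
    rw [List.cons_append, ValidFrom] at hv
    obtain ⟨-, hd, hv⟩ := hv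
    rw [List.cons_append, pathWeight_cons_cons] at hz
    have h0 : 0 ≤ (z : ℤ) + V.w p s := by
      have := (validFrom_iff V _ _).1 hv
      simpa using (this.2 0 (by simp)).1
    obtain ⟨y, hy⟩ := Int.eq_ofNat_of_zero_le h0
    rw [hy] at hv
    obtain ⟨N, h1, h2, h3⟩ := ih (p := s) (z := y) hv (by omega)
    refine ⟨(s, y) :: N, ?_, by simp [h2], ?_⟩
    · rw [List.cons_append, List.isChain_cons_cons]
      exact ⟨⟨hd, by dsimp only; omega⟩, h1⟩
    · intro e he
      rcases List.mem_cons.1 he with rfl | he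
      · refine ⟨[], l, rfl, ?_⟩
        simp only [List.nil_append, pathWeight_cons_cons, pathWeight_singleton]
        omega
      · obtain ⟨A, B, hA, hB⟩ := h3 e he
        refine ⟨s :: A, B, by simp [hA], ?_⟩
        rw [List.cons_append, pathWeight_cons_cons, hB]
        omega

end Lossy

/-! ### Growth of `deltaR` -/

section Growth

variable {V : OneVASS Q} {γ : Q → List Q} {q q' : Q}

theorem exists_least_uprime (hγ : GammaChoice V γ) (hq : q ∈ Qplus V) {r n : ℕ}
    {C : Set (Q × ℕ)} (hC : nActiveIn V γ q r (n + 1) C) (hC' : ¬ nActiveIn V γ q r n C) :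
    ∃ z, (q, z) ∈ Uprime V γ (U V γ n) ∧ z % Wnat V γ q = r ∧
      ∀ u, (q, u) ∈ U V γ n ∪ Uprime V γ (U V γ n) → u % Wnat V γ q = r → z ≤ u := by
  classical
  obtain ⟨hch, hbd, ⟨p, c⟩, ⟨hcU, hcR⟩, ⟨p', c'⟩, hc', hle⟩ := hC
  obtain rfl : p = q := hcR.2.1
  obtain rfl : p' = p := (hch.1 hc').2.1
  have hcr : c % Wnat V γ p' = r := hcR.2.2
  have hc'r : c' % Wnat V γ p' = r := (hch.1 hc').2.2
  dsimp only at hle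
  have hnot : ∀ u, (p', u) ∈ U V γ n → u % Wnat V γ p' = r → ∀ e, (p', e) ∈ C → e < u := by
    intro u hu hur e he
    by_contra! hlt
    exact hC' ⟨hch, hbd, (p', u), ⟨hu, U_subset_confPlus n hu, rfl, hur⟩, (p', e), he, hlt⟩
  obtain ⟨u, hu, hl⟩ := exists_linked_of_mem_U_succ hγ hcU
  have hur : u % Wnat V γ p' = r := Eq.trans hl.2.1.symm hcr
  have huC : ∃ e, (p', e) ∈ C ∧ u ≤ e := by
    rcases le_or_gt u c' with h | h
    · exact ⟨c', hc', h⟩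
    · refine ⟨u, ?_, le_rfl⟩
      have h1 : c' ≡ c [MOD Wnat V γ p'] := hc'r.trans hcr.symm
      rw [← hch.eq_chainOf hγ hq hc']
      refine ⟨⟨confPlus_mono (hch.1 hc').1 h.le, rfl, ?_⟩,
        Or.inl (hl.sub hle h.le le_rfl h1 hl.2.1.symm)⟩
      exact hur.trans hc'r.symm
  obtain ⟨e, he, hue⟩ := huC
  have hu' : (p', u) ∈ Uprime V γ (U V γ n) :=
    hu.resolve_left fun h => absurd (hnot u h hur e he) (by omega)
  have hex : ∃ y, (p', y) ∈ Uprime V γ (U V γ n) ∧ y % Wnat V γ p' = r := ⟨u, hu', hur⟩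
  refine ⟨Nat.find hex, (Nat.find_spec hex).1, (Nat.find_spec hex).2, ?_⟩
  rintro v (hv | hv) hvr
  · have := hnot v hv hvr e he
    have := Nat.find_min' hex ⟨hu', hur⟩
    omega
  · exact Nat.find_min' hex ⟨hv, hvr⟩

theorem le_of_mem_active (hγ : GammaChoice V γ) (hq : q ∈ Qplus V) {r n z y : ℕ}
    (hz : ∀ u, (q, u) ∈ U V γ n ∪ Uprime V γ (U V γ n) → u % Wnat V γ q = r → z ≤ u)
    {C : Set (Q × ℕ)} (hC : nActiveIn V γ q r (n + 1) C) (hy : (q, y) ∈ C)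
    (hyU : (q, y) ∉ U V γ (n + 1)) : z ≤ y := by
  obtain ⟨hch, hbd, ⟨p, c⟩, ⟨hcU, hcR⟩, ⟨p', c'⟩, hc', hle⟩ := hC
  obtain rfl : p = q := hcR.2.1
  obtain rfl : p' = p := (hch.1 hc').2.1
  have hcr : c % Wnat V γ p' = r := hcR.2.2
  have hc'r : c' % Wnat V γ p' = r := (hch.1 hc').2.2
  have hyr : y % Wnat V γ p' = r := (hch.1 hy).2.2
  dsimp only at hle
  have hcy : c ≤ y := by
    by_contra! hlt
    have hl := hch.linked hγ hq hy hc' (by dsimp only; omega)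
    exact hyU (U_succ_of_linked hγ (hch.1 hy).1
      (hl.sub le_rfl hlt.le hle rfl (hcr.trans hyr.symm)) hcU)
  obtain ⟨u, hu, hl⟩ := exists_linked_of_mem_U_succ hγ hcU
  have huy : u ≤ y := by
    by_contra! hlt
    exact hyU (U_succ_of_linked hγ (hch.1 hy).1
      (hl.sub hcy hlt.le le_rfl (hyr.trans hcr.symm) hl.2.1.symm) (U_subset_succ n hu))
  exact (hz u hu (Eq.trans hl.2.1.symm hcr)).trans huy

theorem exists_bounds_of_mem_deltaR (hγ : GammaChoice V γ) (hq : q ∈ Qplus V) {r n z x : ℕ}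
    (hz : ∀ u, (q, u) ∈ U V γ n ∪ Uprime V γ (U V γ n) → u % Wnat V γ q = r → z ≤ u)
    (hx : (q, x) ∈ deltaR V γ (n + 1) q r) :
    ∃ z₁ ≤ x, z ≤ z₁ ∧ ∀ y₀ ≤ x, y₀ % Wnat V γ q = r → ∀ y, Linked V γ q y₀ y → z₁ ≤ y →
      (q, y) ∉ U V γ (n + 1) := by
  obtain ⟨C, hC, hxP, -, hxU, z₁, z₂, ⟨h1, h1U⟩, ⟨h2, h2U⟩, hle1, hle2⟩ := hx
  dsimp only at hle1 hle2
  have hr1 : z₁ % Wnat V γ q = r := (hC.1.1 h1).2.2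
  refine ⟨z₁, hle1, le_of_mem_active hγ hq hz hC h1 h1U, fun y₀ hy₀ hyr y hl hzy hyU => h1U ?_⟩
  have hmod : z₁ ≡ y₀ [MOD Wnat V γ q] := hr1.trans hyr.symm
  refine U_succ_of_linked hγ (hC.1.1 h1).1 ?_ hyU
  rcases le_total y₀ z₁ with h | h
  · exact hl.sub h hzy le_rfl hmod hl.2.1.symm
  · have hl' := hC.1.linked hγ hq h1 h2 (hle1.trans hle2)
    exact (hl'.sub le_rfl h (hy₀.trans hle2) rfl hmod.symm).trans hl

theorem exists_lossyRun_of_uprime {n z : ℕ} (hz : (q, z) ∈ Uprime V γ (U V γ n)) :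
    ∃ q' z' N₀, (q', z') ∈ U V γ n ∧ LossyRun V γ (q, z) N₀ (q', z') ∧
      (z' : ℤ) = z + pathWeight V (lossyPath (q, z) N₀ (q', z')) ∧
      ∀ N, LossyRun V γ (q, z) N (q', z') → N.length ≤ N₀.length →
        ∀ y, z ≤ y → IsValidRun V (lossyPath (q, z) N (q', z')) y → (q, y) ∉ U V γ (n + 1) →
          ∀ v : ℕ, (v : ℤ) = y + pathWeight V (lossyPath (q, z) N (q', z')) →
            (q', v) ∉ U V γ n := by
  obtain ⟨⟨hzP, hzU⟩, k, ⟨π, ⟨q', z'⟩, hU, hv, ⟨hh, hl, hw⟩, hlen⟩, hmin⟩ := hz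
  dsimp only at hv hh hl hw hzU
  obtain ⟨t, rfl⟩ := List.head?_eq_some_iff.1 hh
  rcases List.eq_nil_or_concat t with rfl | ⟨l, s, rfl⟩
  · obtain rfl : q = q' := by simpa using hl
    rw [pathWeight_singleton, add_zero] at hw
    exact absurd (by rwa [show z = z' by exact_mod_cast hw.symm]) hzU
  rw [List.concat_eq_append] at *
  obtain rfl : s = q' := by
    rw [← List.cons_append, List.getLast?_concat] at hl
    simpa using hl
  rw [isValidRun_iff] at hv
  obtain ⟨N₀, h1, h2, h3⟩ := exists_lossyRun_of_validFrom hv hw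
  have hlN : l.length = N₀.length := by rw [← h2]; simp
  have hk : k = N₀.length + 1 := by simp at hlen; omega
  refine ⟨s, z', N₀, hU, ⟨h1, ?_⟩, by rw [lossyPath, h2]; exact hw, ?_⟩
  · rintro ⟨p, e⟩ he heP
    obtain ⟨A, B, rfl, hAe⟩ := h3 _ he
    dsimp only at hAe hv hw hlen
    have e1 : q :: (A ++ p :: B ++ [s]) = (q :: A) ++ p :: (B ++ [s]) := by simp
    rw [e1, validFrom_append_cons, List.cons_append, ← hAe] at hv
    rw [e1, pathWeight_append_cons, List.cons_append, ← add_assoc, ← hAe] at hw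
    rw [e1] at hlen
    simp only [List.cons_append, List.length_cons, List.length_append, List.length_nil] at hlen
    by_cases heU : (p, e) ∈ U V γ n
    · have := hmin (q, z) ⟨hzP, hzU⟩ (A.length + 1) ⟨q :: (A ++ [p]), (p, e), heU,
        (isValidRun_iff _ _ _).2 hv.1, ⟨rfl,
          by rw [← List.cons_append, List.getLast?_concat], hAe⟩, by simp⟩
      omega
    · have := hmin (p, e) ⟨heP, heU⟩ (B.length + 1) ⟨p :: (B ++ [s]), (s, z'), hU,
        (isValidRun_iff _ _ _).2 hv.2, ⟨rfl,
          by rw [← List.cons_append, List.getLast?_concat], hw⟩, by simp⟩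
      omega
  · intro N hN hle y hzy hvy hyU v hv' hvU
    have hyP := confPlus_mono hzP hzy
    have hrun : RunLenTo V (q, y) (U V γ n) (N.length + 1) :=
      ⟨_, (s, v), hvU, hvy, ⟨rfl, by rw [lossyPath, ← List.cons_append, List.getLast?_concat], hv'⟩,
        by simp [lossyPath]⟩
    refine hyU (U_subset_succ n (Or.inr ⟨⟨hyP, fun h => hyU (U_mono n.le_succ h)⟩, _, hrun, ?_⟩))
    intro c hc j hj
    have := hmin c hc j hj
    omega

theorem exists_finset_window (hγ : GammaChoice V γ) (hq : q ∈ Qplus V) {B : Finset ℕ}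
    (hB : ∀ y, (q, y) ∈ ConfPlus V γ → ¬ IsValidRun V (γ q) y → y ∈ B) (Y : Finset ℕ) (m : ℕ) :
    ∃ E : Finset ℕ, E.card ≤ Y.card * m * B.card ∧
      ∀ x, (q, x) ∈ ConfPlus V γ → (q, x) ∉ U V γ 0 →
        ∀ y ∈ Y, y ≤ x → x < y + m * Wnat V γ q → x ∈ E := by
  classical
  have hW := wnat_pos hγ hq
  refine ⟨((Y ×ˢ Finset.range m) ×ˢ B).image fun t =>
    t.1.1 + t.1.2 * Wnat V γ q + (((t.2 : ℤ) - t.1.1) % Wnat V γ q).toNat, ?_, ?_⟩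
  · exact Finset.card_image_le.trans (by simp)
  · intro x hx hxU y hy hyx hxy
    obtain ⟨b, hb, hbv⟩ := exists_blocked_of_notMem_U_zero hγ hx hxU
    have hbB := hB b (confPlus_mono hx hb.1) hbv
    refine Finset.mem_image.2 ⟨((y, (x - y) / Wnat V γ q), b), ?_, ?_⟩
    · simp only [Finset.mem_product, Finset.mem_range]
      exact ⟨⟨hy, (Nat.div_lt_iff_lt_mul hW).2 (by omega)⟩, hbB⟩
    · dsimp only
      have h1 : ((b : ℤ) - y) % Wnat V γ q = ((x - y : ℕ) : ℤ) % Wnat V γ q := by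
        have : (b : ℤ) ≡ x [ZMOD Wnat V γ q] := ((Int.natCast_modEq_iff).2 hb.2.1).symm
        rw [Nat.cast_sub hyx]
        exact this.sub_right _
      rw [h1, ← Int.natCast_mod, Int.toNat_natCast]
      have := Nat.div_add_mod' (x - y) (Wnat V γ q)
      omega

theorem deltaR_finite [Fintype Q] (hV : SingleGuard V) (hγ : GammaChoice V γ)
    (hq : q ∈ Qplus V) (n r : ℕ) : (deltaR V γ n q r).Finite := by
  classical
  obtain ⟨B, -, hB⟩ := exists_finset_gamma_blocked hV hγ hq
  refine ((Finset.range (B.sup id + 1)).finite_toSet.image (Prod.mk q)).subset ?_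
  rintro ⟨p, x⟩ ⟨C, -, hx, rfl, hxU, -⟩
  obtain ⟨b, hb, hbv⟩ := exists_blocked_of_notMem_U_zero hγ hx fun h => hxU (U_mono n.zero_le h)
  have : b ≤ B.sup id := Finset.le_sup (f := id) (hB b (confPlus_mono hx hb.1) hbv)
  exact ⟨x, by have := hb.1; simp; omega, rfl⟩

theorem linked_of_forall_notMem {B : Finset ℕ}
    (hB : ∀ y, (q, y) ∈ ConfPlus V γ → ¬ IsValidRun V (γ q) y → y ∈ B) {a b : ℕ}
    (ha : (q, a) ∈ ConfPlus V γ) (hab : a ≤ b) (hmod : a ≡ b [MOD Wnat V γ q])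
    (h : ∀ y ∈ B, a ≤ y → y < b → ¬ y ≡ a [MOD Wnat V γ q]) : Linked V γ q a b := by
  refine ⟨hab, hmod, fun y h1 h2 h3 => ?_⟩
  by_contra hy
  exact h y (hB y (confPlus_mono ha h1) hy) h1 h2 h3

/-- The largest element of `z + Mℕ` that is at most `t`, for `z ≤ t`. -/
def gridFloor (z M t : ℕ) : ℕ := z + M * ((t - z) / M)

theorem gridFloor_le {z M t : ℕ} (h : z ≤ t) : gridFloor z M t ≤ t := by
  have := Nat.mul_div_le (t - z) M
  unfold gridFloor; omega

theorem lt_gridFloor_add {z M t : ℕ} (hM : 0 < M) : t < gridFloor z M t + M := by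
  have := Nat.lt_mul_div_succ (t - z) hM
  rw [Nat.mul_succ] at this
  unfold gridFloor; omega

theorem gridFloor_eq {z M t x : ℕ} (h1 : gridFloor z M x ≤ t) (h2 : t < gridFloor z M x + M) :
    gridFloor z M t = gridFloor z M x := by
  unfold gridFloor at *
  have hM : 0 < M := by omega
  have : (t - z) / M = (x - z) / M := by
    rw [Nat.div_eq_iff hM]
    have := mul_comm M ((x - z) / M)
    omega
  rw [this]

theorem exists_finset_deltaR_of_dvd (hγ : GammaChoice V γ) {r n z z' P ρ : ℕ} {w : ℤ}
    {B B' F : Finset ℕ}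
    (hB : ∀ y, (q, y) ∈ ConfPlus V γ → ¬ IsValidRun V (γ q) y → y ∈ B)
    (hB' : ∀ y, (q', y) ∈ ConfPlus V γ → ¬ IsValidRun V (γ q') y → y ∈ B')
    (hBc : B.card ≤ P) (hB'c : B'.card ≤ P)
    (hz : (q, z) ∈ ConfPlus V γ) (hzr : z % Wnat V γ q = r)
    (hmin : ∀ u, (q, u) ∈ U V γ n ∪ Uprime V γ (U V γ n) → u % Wnat V γ q = r → z ≤ u)
    (hz' : (q', z') ∈ U V γ n) (hw : (z' : ℤ) ≤ z + w)
    (hmod : (z : ℤ) + w ≡ z' [ZMOD Wnat V γ q'])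
    (hF : ∀ y, z ≤ y → y ∉ F → (q, y) ∉ U V γ (n + 1) → ∀ v : ℕ, (v : ℤ) = y + w →
      (q', v) ∉ U V γ n)
    (hρ : 0 < ρ) (hρP : ρ ≤ P) (hdvd : Wnat V γ q' ∣ ρ * Wnat V γ q) :
    ∃ E : Finset ℕ, E.card ≤ F.card + (3 * P + 2 * F.card) * P * P ∧
      ∀ x, (q, x) ∈ deltaR V γ (n + 1) q r → x ∈ E ∨
        ∃ v : ℕ, (v : ℤ) = x + w ∧ (q', v) ∈ deltaR V γ n q' (z' % Wnat V γ q') := by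
  classical
  have hq : q ∈ Qplus V := hz.1
  have hW := wnat_pos hγ hq
  set M := ρ * Wnat V γ q with hM
  have hMpos : 0 < M := Nat.mul_pos hρ hW
  let t : ℕ → ℕ := fun b => sSup {y | (q, y) ∈ U V γ (n + 1) ∧ Linked V γ q y b}
  let Y : Finset ℕ := B.image (gridFloor z M) ∪ F ∪ F.image (· - M) ∪
    B'.image (fun b : ℕ => gridFloor z M ((b : ℤ) - w).toNat) ∪
    B.image (fun b => gridFloor z M (t b))
  have hYc : Y.card ≤ 3 * P + 2 * F.card := by
    refine (Finset.card_union_le _ _).trans ?_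
    have h1 := Finset.card_union_le (B.image (gridFloor z M) ∪ F ∪ F.image (· - M))
      (B'.image (fun b : ℕ => gridFloor z M ((b : ℤ) - w).toNat))
    have h2 := Finset.card_union_le (B.image (gridFloor z M) ∪ F) (F.image (· - M))
    have h3 := Finset.card_union_le (B.image (gridFloor z M)) F
    have h4 := Finset.card_image_le (s := B) (f := gridFloor z M)
    have h5 := Finset.card_image_le (s := F) (f := (· - M))
    have h6 := Finset.card_image_le (s := B') (f := fun b : ℕ => gridFloor z M ((b : ℤ) - w).toNat)
    have h7 := Finset.card_image_le (s := B) (f := fun b => gridFloor z M (t b))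
    omega
  obtain ⟨E, hEc, hE⟩ := exists_finset_window hγ hq hB Y ρ
  refine ⟨F ∪ E, ?_, ?_⟩
  · refine (Finset.card_union_le _ _).trans (Nat.add_le_add_left (hEc.trans ?_) _)
    gcongr
  intro x hx
  obtain ⟨z₁, hz₁x, hzz₁, hout⟩ := exists_bounds_of_mem_deltaR hγ hq hmin hx
  obtain ⟨-, -, hxP, -, hxU, -⟩ := hx
  by_cases hxE : x ∈ F ∪ E
  · exact Or.inl hxE
  right
  rw [Finset.mem_union, not_or] at hxE
  have hzx : z ≤ x := hzz₁.trans hz₁x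
  set a := gridFloor z M x with ha
  have hax : a ≤ x := gridFloor_le hzx
  have hxa : x < a + M := lt_gridFloor_add hMpos
  have haY : a ∉ Y := fun h =>
    hxE.2 (hE x hxP (fun h => hxU (U_mono (Nat.zero_le _) h)) a h hax hxa)
  simp only [Y, Finset.mem_union, not_or] at haY
  obtain ⟨⟨⟨⟨hY1, hY2⟩, hY3⟩, hY4⟩, hY5⟩ := haY
  have hza : z ≤ a := by rw [ha, gridFloor]; omega
  have haz : a ≡ z [MOD Wnat V γ q] := by
    rw [ha, gridFloor, hM, mul_comm ρ, mul_assoc]; simp [Nat.ModEq]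
  have haP := confPlus_mono hz hza
  have haM : a ≡ a + M [MOD Wnat V γ q] := by rw [hM]; simp [Nat.ModEq]
  have hl : Linked V γ q a (a + M) := by
    refine linked_of_forall_notMem hB haP (by omega) haM fun b hb h1 h2 _ => hY1 ?_
    exact Finset.mem_image.2 ⟨b, hb, gridFloor_eq h1 h2⟩
  have hbU : (q, a + M) ∉ U V γ (n + 1) := hout a hax (Eq.trans haz hzr) _ hl (by omega)
  have haU : (q, a) ∉ U V γ (n + 1) := by
    intro haU
    have hbP := confPlus_mono haP (Nat.le_add_right a M)
    obtain ⟨b, hb, hbv⟩ := exists_blocked_of_notMem_U_zero hγ hbP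
      fun h => hbU (U_mono (Nat.zero_le _) h)
    have hbB := hB b (confPlus_mono hbP hb.1) hbv
    have hmem : a ∈ {y | (q, y) ∈ U V γ (n + 1) ∧ Linked V γ q y b} := ⟨haU, hl.trans hb⟩
    have hbdd : BddAbove {y | (q, y) ∈ U V γ (n + 1) ∧ Linked V γ q y b} :=
      ⟨b, fun y hy => hy.2.1⟩
    have ht := Nat.sSup_mem ⟨a, hmem⟩ hbdd
    have hat : a ≤ t b := le_csSup hbdd hmem
    have hta : t b < a + M := by
      by_contra! hlt
      refine hbU (U_succ_of_linked hγ hbP ?_ ht.1)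
      exact hb.sub le_rfl hlt ht.2.1 rfl (ht.2.2.1.trans hb.2.1.symm)
    exact hY5 (Finset.mem_image.2 ⟨b, hbB, gridFloor_eq hat hta⟩)
  have hbF : a + M ∉ F := fun h => hY3 (Finset.mem_image.2 ⟨_, h, by simp⟩)
  obtain ⟨va, hva⟩ : ∃ v : ℕ, (v : ℤ) = a + w := ⟨((a : ℤ) + w).toNat, by omega⟩
  obtain ⟨vx, hvx⟩ : ∃ v : ℕ, (v : ℤ) = x + w := ⟨((x : ℤ) + w).toNat, by omega⟩
  have hvb : ((va + M : ℕ) : ℤ) = (a + M : ℕ) + w := by push_cast; omega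
  have hvaU := hF a hza hY2 haU va hva
  have hvbU := hF (a + M) (by omega) hbF hbU _ hvb
  have hvxU := hF x hzx hxE.1 hxU vx hvx
  have hz'P := U_subset_confPlus n hz'
  have hvaP := confPlus_mono hz'P (show z' ≤ va by omega)
  have hMW : va ≡ va + M [MOD Wnat V γ q'] := by
    obtain ⟨k, hk⟩ := hdvd
    rw [hk]; simp [Nat.ModEq]
  have hl' : Linked V γ q' va (va + M) := by
    refine linked_of_forall_notMem hB' hvaP (by omega) hMW fun b hb h1 h2 _ => hY4 ?_
    exact Finset.mem_image.2 ⟨b, hb, gridFloor_eq (by omega) (by omega)⟩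
  have hvar : va % Wnat V γ q' = z' % Wnat V γ q' := by
    have h1 : (va : ℤ) ≡ z' [ZMOD Wnat V γ q'] := by
      refine Int.ModEq.trans ?_ hmod
      obtain ⟨k, hk⟩ := hdvd
      rw [hva, ha, gridFloor, hk]
      push_cast
      exact Int.modEq_iff_dvd.2 ⟨-(k * (((x - z) / (Wnat V γ q' * k) : ℕ) : ℤ)), by push_cast; ring⟩
    exact Int.natCast_modEq_iff.1 h1
  have hvaU₀ : (q', va) ∉ U V γ 0 := fun h => hvaU (U_mono n.zero_le h)
  refine ⟨vx, hvx, chainOf V γ q' va, ⟨?_, chainBounded_chainOf hγ hvaP hvaU₀, (q', z'),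
    ⟨hz', hz'P, rfl, rfl⟩, (q', va), mem_chainOf_self hvaP, by dsimp only; omega⟩,
    confPlus_mono hvaP (by omega), rfl, hvxU, va, va + M, ⟨mem_chainOf_self hvaP, hvaU⟩,
    ⟨⟨⟨confPlus_mono hvaP (by omega), rfl, Eq.symm hMW⟩, Or.inl hl'⟩, hvbU⟩,
    by dsimp only; omega, by dsimp only; omega⟩
  rw [← hvar]
  exact isChainIn_chainOf hγ hvaP

theorem exists_modEq_of_card_lt (hγ : GammaChoice V γ) {B' I : Finset ℕ}
    (hB' : ∀ y, (q', y) ∈ ConfPlus V γ → ¬ IsValidRun V (γ q') y → y ∈ B')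
    (hcard : B'.card < I.card) {v : ℕ → ℕ} (hvP : ∀ i ∈ I, (q', v i) ∈ ConfPlus V γ)
    (hvU : ∀ i ∈ I, (q', v i) ∉ U V γ 0) :
    ∃ i ∈ I, ∃ j ∈ I, i ≠ j ∧ v i ≡ v j [MOD Wnat V γ q'] := by
  classical
  have h : ∀ i, ∃ b, i ∈ I → b ∈ B' ∧ v i ≡ b [MOD Wnat V γ q'] := by
    intro i
    by_cases hi : i ∈ I
    · obtain ⟨b, hb, hbv⟩ := exists_blocked_of_notMem_U_zero hγ (hvP i hi) (hvU i hi)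
      exact ⟨b, fun _ => ⟨hB' b (confPlus_mono (hvP i hi) hb.1) hbv, hb.2.1⟩⟩
    · exact ⟨0, fun h => absurd h hi⟩
  choose b hb using h
  obtain ⟨i, hi, j, hj, hij, hbij⟩ := Finset.exists_ne_map_eq_of_card_lt_of_maps_to hcard
    (f := b) fun i hi => (hb i hi).1
  refine ⟨i, hi, j, hj, hij, (hb i hi).2.trans ?_⟩
  rw [hbij]
  exact (hb j hj).2.symm

theorem exists_finset_deltaR_of_not_dvd (hγ : GammaChoice V γ) {r n z z' P : ℕ} {w : ℤ}
    {B B' F : Finset ℕ}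
    (hB : ∀ y, (q, y) ∈ ConfPlus V γ → ¬ IsValidRun V (γ q) y → y ∈ B)
    (hB' : ∀ y, (q', y) ∈ ConfPlus V γ → ¬ IsValidRun V (γ q') y → y ∈ B')
    (hBc : B.card ≤ P) (hB'c : B'.card ≤ P)
    (hz : (q, z) ∈ ConfPlus V γ) (hzr : z % Wnat V γ q = r)
    (hmin : ∀ u, (q, u) ∈ U V γ n ∪ Uprime V γ (U V γ n) → u % Wnat V γ q = r → z ≤ u)
    (hz' : (q', z') ∈ U V γ n) (hw : (z' : ℤ) ≤ z + w)
    (hF : ∀ y, z ≤ y → y ∉ F → (q, y) ∉ U V γ (n + 1) → ∀ v : ℕ, (v : ℤ) = y + w →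
      (q', v) ∉ U V γ n)
    (hdvd : ∀ ρ, 0 < ρ → ρ ≤ P → ¬ Wnat V γ q' ∣ ρ * Wnat V γ q) :
    ∃ E : Finset ℕ, E.card ≤ (P + 2) * (P + F.card) * P ∧
      ∀ x, (q, x) ∈ deltaR V γ (n + 1) q r → x ∈ E := by
  classical
  have hq : q ∈ Qplus V := hz.1
  have hW := wnat_pos hγ hq
  set W := Wnat V γ q with hWdef
  let Y : Finset ℕ := (Finset.range (P + 2) ×ˢ (B ∪ F)).image fun t => t.2 - t.1 * W
  have hYc : Y.card ≤ (P + 2) * (P + F.card) := by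
    refine Finset.card_image_le.trans ?_
    rw [Finset.card_product, Finset.card_range]
    have := Finset.card_union_le B F
    gcongr
    omega
  obtain ⟨E, hEc, hE⟩ := exists_finset_window hγ hq hB Y 1
  refine ⟨E, hEc.trans ?_, fun x hx => ?_⟩
  · rw [mul_one]; gcongr
  obtain ⟨z₁, hz₁x, hzz₁, hout⟩ := exists_bounds_of_mem_deltaR hγ hq hmin hx
  obtain ⟨-, -, hxP, -, hxU, -⟩ := hx
  have hzx : z ≤ x := hzz₁.trans hz₁x
  set a := gridFloor z W x with ha
  have hax : a ≤ x := gridFloor_le hzx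
  have hxa : x < a + W := lt_gridFloor_add hW
  have hza : z ≤ a := by rw [ha, gridFloor]; omega
  have haz : a ≡ z [MOD W] := by rw [ha, gridFloor]; simp [Nat.ModEq]
  have haP := confPlus_mono hz hza
  refine hE x hxP (fun h => hxU (U_mono (Nat.zero_le _) h)) a ?_ hax (by rw [one_mul]; exact hxa)
  by_contra haY
  have hnot : ∀ j < P + 2, a + j * W ∉ B ∪ F := fun j hj h =>
    haY (Finset.mem_image.2 ⟨(j, a + j * W), by simp [hj] at h ⊢; exact h, by simp⟩)
  have hmod : ∀ j, a ≡ a + j * W [MOD W] := fun j => by simp [Nat.ModEq]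
  have hl : Linked V γ q a (a + (P + 2) * W) := by
    refine linked_of_forall_notMem hB haP (by simp) (hmod _) fun b hb h1 h2 h3 => ?_
    obtain ⟨j, hj⟩ := (Nat.modEq_iff_dvd' h1).1 h3.symm
    have hbj : b = a + j * W := by rw [mul_comm, hWdef]; omega
    have hjP : j < P + 2 := by
      have : j * W < (P + 2) * W := by omega
      exact Nat.lt_of_mul_lt_mul_right this
    exact hnot j hjP (hbj ▸ Finset.mem_union_left _ hb)
  have hout' : ∀ j ∈ Finset.Icc 1 (P + 1),
      ((q', (((a + j * W : ℕ) : ℤ) + w).toNat) ∈ ConfPlus V γ) ∧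
      (q', (((a + j * W : ℕ) : ℤ) + w).toNat) ∉ U V γ n := by
    intro j hj
    rw [Finset.mem_Icc] at hj
    have h1 : 1 * W ≤ j * W := Nat.mul_le_mul_right _ hj.1
    have h2 : j * W ≤ (P + 2) * W := Nat.mul_le_mul_right _ (by omega)
    have hlj : Linked V γ q a (a + j * W) :=
      hl.sub le_rfl (by omega) (by omega) rfl (hmod j).symm
    refine ⟨confPlus_mono (U_subset_confPlus n hz') (by omega), ?_⟩
    refine hF (a + j * W) (by omega) (fun h => hnot j (by omega) (Finset.mem_union_right _ h))
      (hout a hax (Eq.trans haz hzr) _ hlj (by omega)) _ (by omega)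
  obtain ⟨i, hi, j, hj, hij, hm⟩ := exists_modEq_of_card_lt hγ hB' (I := Finset.Icc 1 (P + 1))
    (by simp; omega) (fun j hj => (hout' j hj).1)
    (fun j hj h => (hout' j hj).2 (U_mono n.zero_le h))
  have key : ∀ i ∈ Finset.Icc 1 (P + 1), ∀ j ∈ Finset.Icc 1 (P + 1), i < j →
      ¬ (((a + i * W : ℕ) : ℤ) + w).toNat ≡ (((a + j * W : ℕ) : ℤ) + w).toNat
        [MOD Wnat V γ q'] := by
    intro i hi j hj hij hm
    rw [Finset.mem_Icc] at hi hj
    refine hdvd (j - i) (by omega) (by omega) ?_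
    have hle : i * W ≤ j * W := Nat.mul_le_mul_right _ hij.le
    rw [Nat.modEq_iff_dvd' (by omega)] at hm
    rw [Nat.sub_mul]
    convert hm using 1
    omega
  rcases hij.lt_or_gt with h | h
  · exact key i hi j hj h hm
  · exact key j hj i hi h hm.symm

theorem exists_finset_deltaR_of_spread (hγ : GammaChoice V γ) {r n z z' L : ℕ} {w : ℕ → ℤ}
    {B' I : Finset ℕ} {F : ℕ → Finset ℕ}
    (hB' : ∀ y, (q', y) ∈ ConfPlus V γ → ¬ IsValidRun V (γ q') y → y ∈ B')
    (hcard : B'.card < I.card) (hq : q ∈ Qplus V)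
    (hmin : ∀ u, (q, u) ∈ U V γ n ∪ Uprime V γ (U V γ n) → u % Wnat V γ q = r → z ≤ u)
    (hz' : (q', z') ∈ U V γ n) (hw : ∀ i ∈ I, (z' : ℤ) ≤ z + w i) (hFc : ∀ i ∈ I, (F i).card ≤ L)
    (hF : ∀ i ∈ I, ∀ y, z ≤ y → y ∉ F i → (q, y) ∉ U V γ (n + 1) → ∀ v : ℕ, (v : ℤ) = y + w i →
      (q', v) ∉ U V γ n)
    (hinj : ∀ i ∈ I, ∀ j ∈ I, w i ≡ w j [ZMOD Wnat V γ q'] → i = j) :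
    ∃ E : Finset ℕ, E.card ≤ I.card * L ∧
      ∀ x, (q, x) ∈ deltaR V γ (n + 1) q r → x ∈ E := by
  classical
  refine ⟨I.biUnion F, Finset.card_biUnion_le_card_mul _ _ _ hFc, fun x hx => ?_⟩
  obtain ⟨z₁, hz₁x, hzz₁, -⟩ := exists_bounds_of_mem_deltaR hγ hq hmin hx
  obtain ⟨-, -, -, -, hxU, -⟩ := hx
  by_contra hxE
  have hv : ∀ i ∈ I, (q', ((x : ℤ) + w i).toNat) ∈ ConfPlus V γ ∧
      (q', ((x : ℤ) + w i).toNat) ∉ U V γ n := by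
    intro i hi
    have := hw i hi
    refine ⟨confPlus_mono (U_subset_confPlus n hz') (by omega), ?_⟩
    exact hF i hi x (by omega) (fun h => hxE (Finset.mem_biUnion.2 ⟨i, hi, h⟩)) hxU _ (by omega)
  obtain ⟨i, hi, j, hj, hij, hm⟩ := exists_modEq_of_card_lt hγ hB' hcard
    (fun i hi => (hv i hi).1) fun i hi h => (hv i hi).2 (U_mono n.zero_le h)
  refine hij (hinj i hi j hj ?_)
  have h1 := hw i hi
  have h2 := hw j hj
  rw [← Int.natCast_modEq_iff, Int.toNat_of_nonneg (by omega), Int.toNat_of_nonneg (by omega)] at hm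
  exact Int.ModEq.add_left_cancel' _ hm

theorem ncard_deltaR_le_of_forall_mem {m r : ℕ} {E : Finset ℕ}
    (h : ∀ x, (q, x) ∈ deltaR V γ m q r → x ∈ E) : (deltaR V γ m q r).ncard ≤ E.card := by
  classical
  refine (Set.ncard_le_ncard (t := (E.image (Prod.mk q) : Finset (Q × ℕ))) ?_
    (Finset.finite_toSet _)).trans ?_
  · rintro ⟨p, x⟩ hx
    obtain rfl : p = q := by obtain ⟨C, -, -, h, -⟩ := hx; exact h
    exact Finset.mem_coe.2 (Finset.mem_image_of_mem _ (h x hx))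
  · rw [Set.ncard_coe_finset]
    exact Finset.card_image_le

theorem ncard_deltaR_le_of_translate {m m' r r' : ℕ} {w : ℤ} {E : Finset ℕ}
    (hfin : (deltaR V γ m' q' r').Finite)
    (h : ∀ x, (q, x) ∈ deltaR V γ m q r → x ∈ E ∨
      ∃ v : ℕ, (v : ℤ) = x + w ∧ (q', v) ∈ deltaR V γ m' q' r') :
    (deltaR V γ m q r).ncard ≤ (deltaR V γ m' q' r').ncard + E.card := by
  classical
  let G : Finset ℕ := hfin.toFinset.image fun c => ((c.2 : ℤ) - w).toNat
  have hG : G.card ≤ (deltaR V γ m' q' r').ncard := by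
    rw [Set.ncard_eq_toFinset_card _ hfin]
    exact Finset.card_image_le
  refine (ncard_deltaR_le_of_forall_mem (E := G ∪ E) fun x hx => ?_).trans
    ((Finset.card_union_le _ _).trans (Nat.add_le_add_right hG _))
  rw [Finset.mem_union]
  rcases h x hx with h | ⟨v, hv, hmem⟩
  · exact Or.inr h
  · exact Or.inl (Finset.mem_image.2 ⟨(q', v), by simpa using hmem, by dsimp only; omega⟩)

end Growth

/-- Lemma 6: there is a polynomial `p` such that, whenever a residue class `R`
contains a chain that is `(n+1)`-active but not `n`-active,
`|δ_{n+1}(R)| ≤ max{|δ_n(R')| : R' a residue class} + p(|Q|)`. -/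
theorem deltaR_growth_bound :
    ∃ p : Polynomial ℕ,
      ∀ (Q : Type) [Fintype Q] (V : OneVASS Q), SingleGuard V →
        ∀ γ : Q → List Q, GammaChoice V γ →
          ∀ (q : Q) (r n : ℕ), q ∈ Qplus V → r < Wnat V γ q →
            (∃ C, nActiveIn V γ q r (n + 1) C ∧ ¬ nActiveIn V γ q r n C) →
            (deltaR V γ (n + 1) q r).Finite ∧
            ∃ (q₂ : Q) (r₂ : ℕ), q₂ ∈ Qplus V ∧ r₂ < Wnat V γ q₂ ∧
              (deltaR V γ (n + 1) q r).ncard ≤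
                (deltaR V γ n q₂ r₂).ncard + p.eval (Fintype.card Q) := by
  refine ⟨(.X + 1 + 1) * (.X * (.X + 1) + .X + 3) +
    ((.X * (.X + 1) + 2) + (3 * (.X + 1) + 2 * (.X * (.X + 1) + 2)) * (.X + 1) * (.X + 1)) +
    (.X + 1 + 2) * (.X + 1 + (.X * (.X + 1) + 2)) * (.X + 1), ?_⟩
  intro Q _ V hV γ hγ q r n hq hr ⟨C, hC, hC'⟩
  refine ⟨deltaR_finite hV hγ hq _ _, ?_⟩
  simp only [Polynomial.eval_add, Polynomial.eval_mul, Polynomial.eval_X, Polynomial.eval_one,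
    Polynomial.eval_ofNat]
  obtain ⟨z, hz, hzr, hmin⟩ := exists_least_uprime hγ hq hC hC'
  obtain ⟨q', z', N₀, hz', hN₀, hz'w, hout⟩ := exists_lossyRun_of_uprime hz
  have hzP : (q, z) ∈ ConfPlus V γ := hz.1.1
  have hq' : q' ∈ Qplus V := (U_subset_confPlus n hz').1
  obtain ⟨B, hBc, hB⟩ := exists_finset_gamma_blocked hV hγ hq
  obtain ⟨B', hB'c, hB'⟩ := exists_finset_gamma_blocked hV hγ hq'
  have htrans : ∀ N, LossyRun V γ (q, z) N (q', z') → N.length ≤ N₀.length →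
      ∃ F : Finset ℕ, F.card ≤ N.length + 2 ∧ ∀ y, z ≤ y → y ∉ F → (q, y) ∉ U V γ (n + 1) →
        ∀ v : ℕ, (v : ℤ) = y + pathWeight V (lossyPath (q, z) N (q', z')) → (q', v) ∉ U V γ n := by
    intro N hN hle
    obtain ⟨F, hFc, hF⟩ := exists_finset_blocked V hV _ z hN.isRun
    refine ⟨F, hFc.trans (by simp [lossyPath]), fun y hzy hyF hyU v hv => ?_⟩
    exact hout N hN hle y hzy (by by_contra h; exact hyF (hF y hzy h)) hyU v hv
  rcases hN₀.shorten_or_spread hγ (Fintype.card Q + 1) (Wnat V γ q') with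
    ⟨N, hN, hNc, hNle, hmod⟩ | ⟨I, N, hIc, hN, hinj⟩
  · obtain ⟨F, hFc, hF⟩ := htrans N hN hNle
    have hFc' : F.card ≤ Fintype.card Q * (Fintype.card Q + 1) + 2 := hFc.trans (by omega)
    by_cases hρ : ∃ ρ, 0 < ρ ∧ ρ ≤ Fintype.card Q + 1 ∧ Wnat V γ q' ∣ ρ * Wnat V γ q
    · obtain ⟨ρ, hρ0, hρP, hdvd⟩ := hρ
      obtain ⟨E, hEc, hE⟩ := exists_finset_deltaR_of_dvd hγ hB hB' hBc hB'c hzP hzr hmin hz'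
        hN.le_weight (by rw [hz'w]; exact hmod.add_left _) hF hρ0 hρP hdvd
      refine ⟨q', z' % Wnat V γ q', hq', Nat.mod_lt _ (wnat_pos hγ hq'),
        (ncard_deltaR_le_of_translate (deltaR_finite hV hγ hq' _ _) hE).trans ?_⟩
      refine Nat.add_le_add_left (hEc.trans ?_) _
      refine le_trans ?_ (Nat.le_add_right _ _)
      refine le_trans ?_ (Nat.le_add_left _ _)
      gcongr
    · push Not at hρ
      obtain ⟨E, hEc, hE⟩ := exists_finset_deltaR_of_not_dvd hγ hB hB' hBc hB'c hzP hzr hmin hz'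
        hN.le_weight hF hρ
      refine ⟨q, r, hq, hr, (ncard_deltaR_le_of_forall_mem hE).trans (hEc.trans ?_)⟩
      refine le_trans ?_ (Nat.le_add_left _ _)
      refine le_trans ?_ (Nat.le_add_left _ _)
      gcongr
  · choose! F hFc hF using fun i (hi : i ∈ I) => htrans (N i) (hN i hi).1 (hN i hi).2.2
    obtain ⟨E, hEc, hE⟩ := exists_finset_deltaR_of_spread
      (L := Fintype.card Q * (Fintype.card Q + 1) + Fintype.card Q + 3) hγ hB'
      (by omega) hq hmin hz' (fun i hi => (hN i hi).1.le_weight)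
      (fun i hi => (hFc i hi).trans (by have := (hN i hi).2.1; omega)) hF hinj
    refine ⟨q, r, hq, hr, (ncard_deltaR_le_of_forall_mem hE).trans (hEc.trans ?_)⟩
    rw [hIc]
    omega

end VASSPaper
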